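/- arXiv:1707.00412 — 2 statements merged into one kernel-verified Lean document; each statement's English description precedes it below -/
import Mathlib

section
/- For every positive integer d and every real X ≥ 1, ∑_{x ≤ X, gcd(x,d)=1} μ²(x) = (6/π²)·X·∏_{p | d}(1 + 1/p)^{−1} + O(τ(d)·√X), where the sum is over positive integers x ≤ X coprime to d, the product is over primes p dividing d, τ(d) is the number of divisors of d, and the implied constant is absolute. -/
open Finset ArithmeticFunction
open scoped ArithmeticFunction.Moebius

lemma sum_divisors_moebius (n : ℕ) :
    ∑ e ∈ n.divisors, (μ e : ℝ) = if n = 1 then 1 else 0 := by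
  have h := congrArg (· n) (coe_moebius_mul_coe_zeta (R := ℝ))
  simpa only [coe_mul_zeta_apply, one_apply, intCoe_apply] using h

lemma abs_cast_moebius_le_one (n : ℕ) : |(μ n : ℝ)| ≤ 1 := by
  exact_mod_cast abs_moebius_le_one (n := n)

lemma ite_coprime_eq_sum_moebius {n d : ℕ} (hd : d ≠ 0) :
    (if n.Coprime d then (1 : ℝ) else 0) = ∑ e ∈ d.divisors, if e ∣ n then (μ e : ℝ) else 0 := by
  rw [← sum_filter, if_congr (Nat.coprime_iff_gcd_eq_one).symm rfl rfl, ← sum_divisors_moebius]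
  congr 1
  ext e
  simp [Nat.dvd_gcd_iff, hd, and_comm]

lemma ite_squarefree_eq_sum_moebius {n K : ℕ} (hn : n ≠ 0) (hK : n.sqrt ≤ K) :
    (if Squarefree n then (1 : ℝ) else 0) =
      ∑ k ∈ Icc 1 K, if k ^ 2 ∣ n then (μ k : ℝ) else 0 := by
  obtain ⟨a, b, rfl, ha⟩ := Nat.sq_mul_squarefree n
  have hb : b ≠ 0 := by rintro rfl; simp at hn
  have hdvd (k : ℕ) : k ^ 2 ∣ b ^ 2 * a ↔ k ∣ b := by
    refine ⟨fun h ↦ ?_, fun h ↦ (pow_dvd_pow_of_dvd h 2).mul_right a⟩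
    obtain ⟨g, k', b', hg, hco, rfl, rfl⟩ := Nat.exists_coprime' (Nat.gcd_pos_of_pos_right k hb.bot_lt)
    have h2 : k' ^ 2 ∣ a := by
      rw [mul_pow, mul_pow, mul_right_comm] at h
      exact (hco.pow 2 2).dvd_of_dvd_mul_left (Nat.dvd_of_mul_dvd_mul_right (by positivity) h)
    have : k' = 1 := by simpa using ha k' (by rwa [← sq])
    simp [this]
  have hfilter : {k ∈ Icc 1 K | k ^ 2 ∣ b ^ 2 * a} = b.divisors := by
    ext k
    simp only [mem_filter, mem_Icc, hdvd, Nat.mem_divisors]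
    refine ⟨fun h ↦ ⟨h.2, hb⟩, fun h ↦ ⟨⟨Nat.pos_of_dvd_of_pos h.1 hb.bot_lt, ?_⟩, h.1⟩⟩
    refine (Nat.le_sqrt'.2 (Nat.le_of_dvd hn.bot_lt ((hdvd k).2 h.1))).trans hK
  rw [← sum_filter, hfilter, sum_divisors_moebius]
  congr 1
  refine propext ⟨fun h ↦ ?_, fun h ↦ by simpa [h] using ha⟩
  simpa using h b (by rw [← sq]; exact dvd_mul_right _ _)

lemma abs_sum_ite_coprime_sub_le {d : ℕ} (hd : d ≠ 0) {Y : ℝ} (hY : 0 ≤ Y) :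
    |(∑ m ∈ Icc 1 ⌊Y⌋₊, if m.Coprime d then (1 : ℝ) else 0)
        - Y * ∏ p ∈ d.primeFactors, (1 - (p : ℝ)⁻¹)| ≤ #d.divisors := by
  wlog hsq : Squarefree d generalizing d
  · set r := ∏ p ∈ d.primeFactors, p with hr
    have hr0 : r ≠ 0 := prod_ne_zero_iff.2 fun p hp ↦ (Nat.prime_of_mem_primeFactors hp).ne_zero
    have hrp : r.primeFactors = d.primeFactors :=
      Nat.primeFactors_prod fun p hp ↦ Nat.prime_of_mem_primeFactors hp
    have hrs : Squarefree r := by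
      rw [hr, ← Nat.radical_eq_prod_primeFactors]
      exact UniqueFactorizationMonoid.squarefree_radical
    have h := this hr0 hrs
    have hco (m : ℕ) : m ∈ Icc 1 ⌊Y⌋₊ → (m.Coprime r ↔ m.Coprime d) := fun hm ↦ by
      have hm0 : m ≠ 0 := by have := (mem_Icc.1 hm).1; lia
      rw [← Nat.disjoint_primeFactors hm0 hr0, ← Nat.disjoint_primeFactors hm0 hd, hrp]
    rw [hrp, sum_congr rfl fun m hm ↦ if_congr (hco m hm) rfl rfl] at h
    refine h.trans ?_
    exact_mod_cast card_le_card (Nat.divisors_subset_of_dvd hd (Nat.prod_primeFactors_dvd d))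
  let f : ArithmeticFunction ℝ := ⟨fun n ↦ (n : ℝ)⁻¹, by simp⟩
  have hf : f.IsMultiplicative := ⟨by simp [f], fun _ ↦ by simp [f, mul_comm]⟩
  have hprod : ∏ p ∈ d.primeFactors, (1 - (p : ℝ)⁻¹) = ∑ e ∈ d.divisors, (μ e : ℝ) * (e : ℝ)⁻¹ :=
    hf.prodPrimeFactors_one_sub_of_squarefree f hsq
  have hsum : (∑ m ∈ Icc 1 ⌊Y⌋₊, if m.Coprime d then (1 : ℝ) else 0) =
      ∑ e ∈ d.divisors, (μ e : ℝ) * (⌊Y / e⌋₊ : ℝ) := by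
    simp_rw [ite_coprime_eq_sum_moebius hd]
    rw [sum_comm]
    refine sum_congr rfl fun e _ ↦ ?_
    rw [← sum_filter, sum_const, nsmul_eq_mul, mul_comm, Nat.floor_div_natCast,
      ← Nat.Ioc_filter_dvd_card_eq_div]
    rfl
  rw [hprod, hsum, mul_sum, ← sum_sub_distrib]
  refine (abs_sum_le_sum_abs _ _).trans ?_
  rw [card_eq_sum_ones, Nat.cast_sum]
  refine sum_le_sum fun e _ ↦ ?_
  rw [show (μ e : ℝ) * (⌊Y / e⌋₊ : ℝ) - Y * (μ e * (e : ℝ)⁻¹) = μ e * (⌊Y / e⌋₊ - Y / e) by ring,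
    abs_mul, Nat.cast_one]
  refine mul_le_one₀ (abs_cast_moebius_le_one e) (abs_nonneg _) ?_
  have h1 := Nat.floor_le (show 0 ≤ Y / e by positivity)
  have h2 := Nat.lt_floor_add_one (Y / e)
  rw [abs_le]
  constructor <;> linarith

lemma sum_ite_coprime_squarefree (d N : ℕ) :
    (∑ x ∈ Icc 1 N, if x.Coprime d ∧ Squarefree x then (1 : ℝ) else 0) =
      ∑ k ∈ Icc 1 N.sqrt, (if k.Coprime d then (μ k : ℝ) else 0) *
        ∑ m ∈ Icc 1 (N / k ^ 2), if m.Coprime d then (1 : ℝ) else 0 := by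
  have hx (x : ℕ) (hx : x ∈ Icc 1 N) : (if x.Coprime d ∧ Squarefree x then (1 : ℝ) else 0) =
      ∑ k ∈ Icc 1 N.sqrt, if k ^ 2 ∣ x then (if x.Coprime d then (μ k : ℝ) else 0) else 0 := by
    rw [mem_Icc] at hx
    have := ite_squarefree_eq_sum_moebius (n := x) (by lia) (Nat.sqrt_le_sqrt hx.2)
    by_cases h : x.Coprime d
    · simpa only [if_pos h, ite_and] using this
    · simp [h]
  rw [sum_congr rfl hx, sum_comm]
  refine sum_congr rfl fun k hk ↦ ?_
  have hk0 : 0 < k ^ 2 := by have := (mem_Icc.1 hk).1; positivity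
  rw [← sum_filter, mul_sum]
  symm
  refine sum_bij (fun m _ ↦ k ^ 2 * m) (fun m hm ↦ ?_) (fun m _ m' _ h ↦ ?_) (fun x hx ↦ ?_)
    fun m _ ↦ ?_
  · rw [mem_Icc, Nat.le_div_iff_mul_le hk0] at hm
    simp only [mem_filter, mem_Icc, dvd_mul_right, and_true]
    exact ⟨Nat.mul_pos hk0 hm.1, by lia⟩
  · exact Nat.eq_of_mul_eq_mul_left hk0 h
  · obtain ⟨hx, m, rfl⟩ := mem_filter.1 hx
    rw [mem_Icc] at hx
    refine ⟨m, ?_, rfl⟩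
    rw [mem_Icc, Nat.le_div_iff_mul_le hk0]
    exact ⟨Nat.pos_of_mul_pos_left hx.1, by lia⟩
  · rw [if_congr (Nat.coprime_mul_iff_left.trans
      (and_congr_left' (Nat.coprime_pow_left_iff two_pos k d))) rfl rfl, ite_and, ite_mul, mul_ite]
    simp

lemma hasSum_moebius_coprime_div_sq {d : ℕ} (hd : d ≠ 0) :
    HasSum (fun k : ℕ ↦ (if k.Coprime d then (μ k : ℝ) else 0) / (k : ℝ) ^ 2)
      (6 / Real.pi ^ 2 * ∏ p ∈ d.primeFactors, (1 - ((p : ℝ) ^ 2)⁻¹)⁻¹) := by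
  have : NeZero d := ⟨hd⟩
  let χ : DirichletCharacter ℂ d := 1
  have h2 : 1 < (2 : ℂ).re := by norm_num
  have hχ : LSeries (χ ·) 2 = riemannZeta 2 * ∏ p ∈ d.primeFactors, (1 - (p : ℂ) ^ (-2 : ℂ)) := by
    rw [← DirichletCharacter.LFunction_eq_LSeries χ h2]
    rw [mul_comm]
    exact DirichletCharacter.LFunctionTrivChar_eq_mul_riemannZeta (N := d) (s := 2) (by norm_num)
  have hs := (DirichletCharacter.LSeriesSummable_mul χ
    (LSeriesSummable_moebius_iff.2 h2)).LSeriesHasSum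
  rw [eq_inv_of_mul_eq_one_right (DirichletCharacter.LSeries.mul_mu_eq_one χ h2), hχ,
    riemannZeta_two, LSeriesHasSum] at hs
  rw [← Complex.hasSum_ofReal]
  convert hs using 1
  · ext k
    rcases eq_or_ne k 0 with rfl | hk
    · simp
    · rw [LSeries.term_of_ne_zero hk]
      by_cases h : k.Coprime d
      · have : IsUnit (k : ZMod d) := (ZMod.isUnit_iff_coprime k d).2 h
        simp [χ, if_pos h, MulChar.one_apply this]
      · have : ¬ IsUnit (k : ZMod d) := fun h' ↦ h ((ZMod.isUnit_iff_coprime k d).1 h')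
        simp [χ, h, MulChar.map_nonunit _ this]
  · push_cast
    rw [mul_inv, inv_div, ← prod_inv_distrib]
    congr! 4 with p _
    rw [Complex.cpow_neg]
    norm_cast

lemma abs_sum_Icc_sub_le_of_hasSum {a : ℕ → ℝ} (ha : ∀ k, |a k| ≤ 1) {L : ℝ}
    (hL : HasSum (fun k : ℕ ↦ a k / (k : ℝ) ^ 2) L) (K : ℕ) :
    |(∑ k ∈ Icc 1 K, a k / (k : ℝ) ^ 2) - L| ≤ 2 / (K + 1) := by
  have hlim : Filter.Tendsto
      (fun n ↦ |(∑ k ∈ Icc 1 K, a k / (k : ℝ) ^ 2) - ∑ k ∈ range n, a k / (k : ℝ) ^ 2|)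
      Filter.atTop (nhds |(∑ k ∈ Icc 1 K, a k / (k : ℝ) ^ 2) - L|) :=
    (tendsto_const_nhds.sub hL.tendsto_sum_nat).abs
  refine le_of_tendsto hlim (Filter.eventually_atTop.2 ⟨K + 1, fun n hn ↦ ?_⟩)
  have hsplit : ∑ k ∈ range n, a k / (k : ℝ) ^ 2 =
      (∑ k ∈ Icc 1 K, a k / (k : ℝ) ^ 2) + ∑ k ∈ Ioo K n, a k / (k : ℝ) ^ 2 := by
    rw [← sum_union (by rw [disjoint_left]; intro k; simp; lia)]
    refine (sum_subset (fun k ↦ by simp; lia) fun k hk hk' ↦ ?_).symm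
    have : k = 0 := by simp at hk hk'; lia
    simp [this]
  rw [hsplit, sub_add_cancel_left, abs_neg]
  refine (abs_sum_le_sum_abs _ _).trans (le_trans (sum_le_sum fun k _ ↦ ?_)
    (sum_Ioo_inv_sq_le (α := ℝ) K n))
  rw [abs_div, abs_of_nonneg (sq_nonneg (k : ℝ)), ← one_div]
  gcongr
  exact ha k


/-- For every positive integer `d` and real `X ≥ 1`,
`∑_{x ≤ X, gcd(x,d)=1} μ²(x) = (6/π²)·X·∏_{p ∣ d}(1+1/p)⁻¹ + O(τ(d)·√X)`
with an absolute implied constant. -/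
theorem stmt_14 :
    ∃ C : ℝ, 0 < C ∧ ∀ d : ℕ, 0 < d → ∀ X : ℝ, 1 ≤ X →
      |(∑ x ∈ Finset.Icc 1 ⌊X⌋₊,
          if Nat.Coprime x d ∧ Squarefree x then (1 : ℝ) else 0)
        - 6 / Real.pi ^ 2 * X * ∏ p ∈ d.primeFactors, (1 + 1 / (p : ℝ))⁻¹|
      ≤ C * d.divisors.card * Real.sqrt X := by
  refine ⟨3, by norm_num, fun d hd X hX ↦ ?_⟩
  set N := ⌊X⌋₊
  set P := ∏ p ∈ d.primeFactors, (1 - (p : ℝ)⁻¹)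
  set Q := ∏ p ∈ d.primeFactors, (1 - ((p : ℝ) ^ 2)⁻¹)⁻¹
  set a : ℕ → ℝ := fun k ↦ if k.Coprime d then (μ k : ℝ) else 0
  have ha (k : ℕ) : |a k| ≤ 1 := by
    by_cases h : k.Coprime d
    · simpa only [a, if_pos h] using abs_cast_moebius_le_one k
    · simp [a, h]
  have hp (p : ℕ) (hp : p ∈ d.primeFactors) : 1 < (p : ℝ) := by
    exact_mod_cast (Nat.prime_of_mem_primeFactors hp).one_lt
  have hPQ : ∏ p ∈ d.primeFactors, (1 + 1 / (p : ℝ))⁻¹ = P * Q := by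
    rw [← prod_mul_distrib]
    refine prod_congr rfl fun p hp' ↦ ?_
    have h1 := hp p hp'
    have h2 : (p : ℝ) - 1 ≠ 0 := by linarith
    have h3 : (p : ℝ) ^ 2 - 1 ≠ 0 := by nlinarith
    have h4 : (p : ℝ) + 1 ≠ 0 := by linarith
    have h5 : (p : ℝ) ≠ 0 := by linarith
    rw [show (1 : ℝ) + 1 / p = (p + 1) / p by field_simp,
      show (1 : ℝ) - (p : ℝ)⁻¹ = (p - 1) / p by field_simp,
      show (1 : ℝ) - ((p : ℝ) ^ 2)⁻¹ = (p ^ 2 - 1) / p ^ 2 by field_simp]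
    field_simp
    ring
  have hP : |P| ≤ 1 := by
    rw [abs_prod]
    refine prod_le_one (fun _ _ ↦ abs_nonneg _) fun p hp' ↦ ?_
    have h1 := inv_le_one_of_one_le₀ (hp p hp').le
    have h0 : 0 ≤ (p : ℝ)⁻¹ := by positivity
    rw [abs_le]
    constructor <;> linarith
  set S := ∑ k ∈ Icc 1 N.sqrt, a k / (k : ℝ) ^ 2
  have hX0 : 0 < √X := by positivity
  have hXX : √X * √X = X := Real.mul_self_sqrt (by linarith)
  have hsqrt_le : (N.sqrt : ℝ) ≤ √X :=
    Real.nat_sqrt_le_real_sqrt.trans (Real.sqrt_le_sqrt (Nat.floor_le (by linarith)))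
  have hlt_sqrt : √X < N.sqrt + 1 := by
    rw [Real.sqrt_lt' (by positivity)]
    have h : N + 1 ≤ (N.sqrt + 1) ^ 2 := by
      rw [sq]; exact Nat.lt_succ_sqrt N
    calc X < N + 1 := Nat.lt_floor_add_one X
      _ ≤ _ := by exact_mod_cast h
  have htail : |S - 6 / Real.pi ^ 2 * Q| ≤ 2 / √X :=
    (abs_sum_Icc_sub_le_of_hasSum ha (hasSum_moebius_coprime_div_sq hd.ne') N.sqrt).trans
      (by gcongr)
  have hcount : |(∑ x ∈ Icc 1 N, if x.Coprime d ∧ Squarefree x then (1 : ℝ) else 0) - X * P * S| ≤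
      #d.divisors * √X := by
    rw [sum_ite_coprime_squarefree, mul_sum, ← sum_sub_distrib]
    refine (abs_sum_le_sum_abs _ _).trans ((sum_le_card_nsmul _ _ (#d.divisors : ℝ)
      fun k _ ↦ ?_).trans ?_)
    · have h := abs_sum_ite_coprime_sub_le hd.ne' (Y := X / k ^ 2) (by positivity)
      rw [← Nat.cast_pow, Nat.floor_div_natCast, Nat.cast_pow] at h
      rw [show X * P * (a k / (k : ℝ) ^ 2) = a k * (X / k ^ 2 * P) by ring, ← mul_sub, abs_mul]
      exact (mul_le_of_le_one_left (abs_nonneg _) (ha k)).trans h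
    · rw [Nat.card_Icc, Nat.add_sub_cancel, nsmul_eq_mul, mul_comm]
      gcongr
  have hmain : |X * P * S - 6 / Real.pi ^ 2 * X * (P * Q)| ≤ 2 * √X := by
    rw [show X * P * S - 6 / Real.pi ^ 2 * X * (P * Q) = X * (P * (S - 6 / Real.pi ^ 2 * Q)) by
      ring, abs_mul, abs_mul, abs_of_nonneg (by linarith : 0 ≤ X)]
    calc X * (|P| * |S - 6 / Real.pi ^ 2 * Q|) ≤ X * (1 * (2 / √X)) := by gcongr
      _ = 2 * √X := by
        field_simp
        linarith
  have hτ : (1 : ℝ) ≤ #d.divisors := by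
    exact_mod_cast card_pos.2 (Nat.nonempty_divisors.2 hd.ne')
  rw [hPQ]
  calc _ ≤ #d.divisors * √X + 2 * √X := (abs_sub_le _ _ _).trans (add_le_add hcount hmain)
    _ ≤ _ := by nlinarith
end

section
/- Let m, a₁, b₁ be pairwise coprime squarefree integers with m·a₁ ≠ 1, m·b₁ ≠ 1 and a₁·b₁ ≠ 1, and let K = ℚ(√(m a₁), √(m b₁)), a biquadratic extension of ℚ. Then the discriminant of K equals c²·m²·a₁²·b₁², where c = 1 if all three of m a₁, m b₁, a₁ b₁ are ≡ 1 (mod 4); c = 4 if exactly one of them is ≡ 1 (mod 4); and c = 8 if none of them is ≡ 1 (mod 4). -/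
open scoped Classical

/-- The discriminant of a finite-dimensional intermediate field of `ℚ̄/ℚ`
(junk value `0` in the infinite-dimensional case). -/
noncomputable def biquadDiscr (K : IntermediateField ℚ (AlgebraicClosure ℚ)) : ℤ :=
  if h : FiniteDimensional ℚ K then
    letI := h
    letI : NumberField K := ⟨⟩
    NumberField.discr K
  else 0

theorem rat_of_sq_eq_mul_sq {n : ℤ} (hn : Squarefree n) (h1 : n ≠ 1) {u v : ℚ}
    (h : u ^ 2 = n * v ^ 2) : u = 0 ∧ v = 0 := by
  by_cases hv : v = 0
  · subst hv
    exact ⟨by simpa using h, rfl⟩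
  · exfalso
    have hs : IsSquare (n : ℚ) := ⟨u / v, by field_simp; linarith⟩
    rw [Rat.isSquare_intCast_iff] at hs
    obtain ⟨k, rfl⟩ := hs
    exact h1 (Int.isUnit_mul_self (hn k dvd_rfl))

theorem Squarefree.exists_int_of_mul_sq {n : ℤ} (hn : Squarefree n) {t : ℚ} {k : ℤ}
    (h : n * t ^ 2 = k) : ∃ j : ℤ, t = j := by
  have hd : (t.den : ℚ) ≠ 0 := by exact_mod_cast t.den_nz
  have h2 : n * t.num ^ 2 = k * (t.den : ℤ) ^ 2 := by
    rw [← Rat.num_div_den t] at h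
    field_simp at h
    rw [mul_comm k]
    exact_mod_cast h
  have hc : IsCoprime ((t.den : ℤ) ^ 2) (t.num ^ 2) :=
    IsCoprime.pow (Int.isCoprime_iff_gcd_eq_one.mpr (by
      simpa [Int.gcd, Nat.coprime_comm] using t.reduced.symm))
  have hdv : (t.den : ℤ) * t.den ∣ n := by
    rw [← sq]
    exact hc.dvd_of_dvd_mul_right ⟨k, by rw [h2]; ring⟩
  have hden : t.den = 1 := by simpa using Int.isUnit_iff_natAbs_eq.mp (hn _ hdv)
  exact ⟨t.num, (Rat.coe_int_num_of_den_eq_one hden).symm⟩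

theorem exists_int_of_isIntegral_ratCast {K : Type*} [Field K] [CharZero K] {r : ℚ}
    (h : IsIntegral ℤ (r : K)) : ∃ n : ℤ, r = n := by
  have h' : IsIntegral ℤ r :=
    (isIntegral_algebraMap_iff (algebraMap ℚ K).injective).mp (by simpa using h)
  obtain ⟨n, hn⟩ := IsIntegrallyClosed.isIntegral_iff.mp h'
  exact ⟨n, by simpa using hn.symm⟩

theorem discr_eq_of_span {K : Type*} [Field K] [NumberField K] {ι : Type*} [Fintype ι]
    [DecidableEq ι] (v : ι → K) (hv : ∀ i, IsIntegral ℤ (v i))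
    (hsp : ∀ α : K, IsIntegral ℤ α → ∃ c : ι → ℤ, α = ∑ i, c i • v i)
    (hd : Algebra.discr ℚ v ≠ 0) : (NumberField.discr K : ℚ) = Algebra.discr ℚ v := by
  have hli : LinearIndependent ℚ v := by
    by_contra h
    exact hd (Algebra.discr_zero_of_not_linearIndependent ℚ h)
  have hliZ : LinearIndependent ℤ v := LinearIndependent.restrict_scalars' ℤ hli
  let w : ι → NumberField.RingOfIntegers K := fun i => ⟨v i, hv i⟩
  have hw : LinearIndependent ℤ w :=
    LinearIndependent.of_comp
      (Algebra.linearMap (NumberField.RingOfIntegers K) K |>.restrictScalars ℤ) hliZ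
  have hwt : ⊤ ≤ Submodule.span ℤ (Set.range w) := by
    intro α _
    obtain ⟨c, hc⟩ := hsp α α.2
    have : α = ∑ i, c i • w i := by
      apply NumberField.RingOfIntegers.ext
      change (α : K) = algebraMap (NumberField.RingOfIntegers K) K _
      rw [hc, map_sum]
      exact Finset.sum_congr rfl fun i _ =>
        (map_zsmul (algebraMap (NumberField.RingOfIntegers K) K) (c i) (w i)).symm
    rw [this]
    exact Submodule.sum_mem _ fun i _ => Submodule.smul_mem _ _ (Submodule.subset_span ⟨i, rfl⟩)
  let B := Module.Basis.mk hw hwt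
  rw [← NumberField.discr_eq_discr K B]
  have hloc := Algebra.discr_localizationLocalization (Rₘ := ℚ) ℤ (nonZeroDivisors ℤ) K B
  rw [eq_intCast] at hloc
  rw [← hloc]
  congr 1
  ext i
  rw [Module.Basis.localizationLocalization_apply, Module.Basis.mk_apply]
  rfl

theorem even_of_sq_sub_mul_sq {n A B N : ℤ} (hn : n % 4 = 2 ∨ n % 4 = 3)
    (h : A ^ 2 - n * B ^ 2 = 4 * N) : 2 ∣ A ∧ 2 ∣ B := by
  rcases Int.even_or_odd' A with ⟨u, rfl | rfl⟩ <;> rcases Int.even_or_odd' B with ⟨v, rfl | rfl⟩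
  · exact ⟨⟨_, rfl⟩, ⟨_, rfl⟩⟩
  all_goals
    exfalso
    ring_nf at h
    omega

theorem two_dvd_sub_of_sq_sub_mul_sq {n A B N : ℤ} (hn : n % 2 = 1)
    (h : A ^ 2 - n * B ^ 2 = 4 * N) : 2 ∣ A - B := by
  obtain ⟨k, rfl⟩ : ∃ k, n = 2 * k + 1 := ⟨n / 2, by omega⟩
  rcases Int.even_or_odd' A with ⟨u, rfl | rfl⟩ <;> rcases Int.even_or_odd' B with ⟨v, rfl | rfl⟩ <;>
    ring_nf at h <;> omega

theorem Int.odd_mul_mod_four {a b : ℤ} (h : a * b % 2 = 1) :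
    (∃ i, a = 2 * i + 1) ∧ ∃ l, b = a * (a * b) + 4 * l := by
  have ha : a % 2 = 1 := Int.odd_iff.mp (Int.odd_mul.mp (Int.odd_iff.mpr h)).1
  obtain ⟨i, rfl⟩ : ∃ i, a = 2 * i + 1 := ⟨a / 2, by omega⟩
  exact ⟨⟨i, rfl⟩, -b * (i ^ 2 + i), by ring⟩

theorem congr_of_all_one_mod_four {m a b A B C D E F N₁ N₂ N₃ : ℤ} (h₁ : m * a % 4 = 1)
    (h₂ : m * b % 4 = 1) (h₃ : a * b % 4 = 1) (hx : A ^ 2 - m * a * B ^ 2 = 4 * N₁)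
    (hy : A ^ 2 - m * b * C ^ 2 = 4 * N₂) (hz : A ^ 2 - a * b * D ^ 2 = 4 * N₃)
    (hE : A ^ 2 + m * a * B ^ 2 - m * b * C ^ 2 - a * b * D ^ 2 = 8 * E)
    (hF : A * B - b * C * D = 4 * F) :
    2 ∣ B - D ∧ 2 ∣ C - a * D ∧ 4 ∣ A - B - C + a * D := by
  have hB := two_dvd_sub_of_sq_sub_mul_sq (by omega) hx
  have hC := two_dvd_sub_of_sq_sub_mul_sq (by omega) hy
  have hD := two_dvd_sub_of_sq_sub_mul_sq (by omega) hz
  obtain ⟨⟨i, hi⟩, l, hl⟩ := Int.odd_mul_mod_four (a := a) (b := b) (by omega)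
  obtain ⟨k₁, hk₁⟩ : ∃ k, m * a = 4 * k + 1 := ⟨m * a / 4, by omega⟩
  obtain ⟨k₂, hk₂⟩ : ∃ k, m * b = 4 * k + 1 := ⟨m * b / 4, by omega⟩
  obtain ⟨k₃, hk₃⟩ : ∃ k, a * b = 4 * k + 1 := ⟨a * b / 4, by omega⟩
  rw [hk₁, hk₂, hk₃] at hE
  rw [hk₃, hi] at hl
  rw [hl] at hF
  rw [hi]
  rcases Int.even_or_odd' A with ⟨p, rfl | rfl⟩
  · obtain ⟨q, rfl⟩ : 2 ∣ B := by omega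
    obtain ⟨r, rfl⟩ : 2 ∣ C := by omega
    obtain ⟨s, rfl⟩ : 2 ∣ D := by omega
    have hpar : 2 ∣ p ^ 2 + q ^ 2 - r ^ 2 - s ^ 2 := by
      ring_nf at hE ⊢
      omega
    have h2 (t : ℤ) : ∃ c, t ^ 2 = t + 2 * c := by
      rcases Int.even_or_odd' t with ⟨c, rfl | rfl⟩
      · exact ⟨2 * c ^ 2 - c, by ring⟩
      · exact ⟨2 * c ^ 2 + c, by ring⟩
    obtain ⟨_, hp⟩ := h2 p
    obtain ⟨_, hq⟩ := h2 q
    obtain ⟨_, hr⟩ := h2 r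
    obtain ⟨_, hs⟩ := h2 s
    ring_nf
    omega
  · obtain ⟨q, rfl⟩ : ∃ q, B = 2 * q + 1 := ⟨B / 2, by omega⟩
    obtain ⟨r, rfl⟩ : ∃ q, C = 2 * q + 1 := ⟨C / 2, by omega⟩
    obtain ⟨s, rfl⟩ : ∃ q, D = 2 * q + 1 := ⟨D / 2, by omega⟩
    ring_nf at hF ⊢
    omega

theorem congr_of_one_mod_four {m a b A B C D E F N : ℤ} (h₁ : m * a % 4 = 2 ∨ m * a % 4 = 3)
    (h₃ : a * b % 4 = 1) (hE : A ^ 2 + a * b * D ^ 2 - a * m * B ^ 2 - b * m * C ^ 2 = 2 * E)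
    (hF : A * D - m * B * C = F) (hN : E ^ 2 - a * b * F ^ 2 = 4 * N) : 2 ∣ A - D ∧ 2 ∣ B - C := by
  obtain ⟨e, he⟩ := two_dvd_sub_of_sq_sub_mul_sq (by omega) hN
  obtain ⟨⟨i, hi⟩, l, hl⟩ := Int.odd_mul_mod_four (a := a) (b := b) (by omega)
  obtain ⟨k, hk⟩ : ∃ k, a * b = 4 * k + 1 := ⟨a * b / 4, by omega⟩
  refine even_of_sq_sub_mul_sq h₁ (N := e - k * D ^ 2 + m * ((l + a * k) * C ^ 2 + i * B * C)) ?_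
  rw [hk] at hE hl
  linear_combination hE - 2 * hF + 2 * he + m * C ^ 2 * hl + 2 * m * B * C * hi

theorem congr_of_three_mod_four {m a b A B C D E F N : ℤ} (hm : m % 4 = 2) (h₃ : a * b % 4 = 3)
    (hE : A ^ 2 + a * b * D ^ 2 - a * m * B ^ 2 - b * m * C ^ 2 = 2 * E)
    (hF : A * D - m * B * C = F) (hN : E ^ 2 - a * b * F ^ 2 = 4 * N) :
    2 ∣ A ∧ 2 ∣ D ∧ 2 ∣ B - C := by
  obtain ⟨⟨E, rfl⟩, ⟨F, rfl⟩⟩ := even_of_sq_sub_mul_sq (by omega) hN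
  obtain ⟨⟨i, hi⟩, l, hl⟩ := Int.odd_mul_mod_four (a := a) (b := b) (by omega)
  obtain ⟨k, hk⟩ : ∃ k, a * b = 4 * k + 3 := ⟨a * b / 4, by omega⟩
  obtain ⟨j, rfl⟩ : ∃ j, m = 4 * j + 2 := ⟨m / 4, by omega⟩
  rw [hk] at hE hl
  rw [hl, hi] at hE
  clear hN hl hk h₃
  rcases Int.even_or_odd' A with ⟨A, rfl | rfl⟩ <;> rcases Int.even_or_odd' D with ⟨D, rfl | rfl⟩ <;>
  rcases Int.even_or_odd' B with ⟨B, rfl | rfl⟩ <;> rcases Int.even_or_odd' C with ⟨C, rfl | rfl⟩ <;>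
    ring_nf at hE hF <;> omega

/-- The field `K` is the biquadratic extension of `ℚ` generated by the square roots `x`, `y`, `z`
of `m * a`, `m * b`, `a * b`. -/
structure IsBiquadratic {K : Type*} [Field K] [CharZero K] (m a b : ℤ) (x y z : K) : Prop where
  sq_x : x ^ 2 = m * a
  sq_y : y ^ 2 = m * b
  sq_z : z ^ 2 = a * b
  mul_xy : x * y = m * z
  mul_xz : x * z = a * y
  mul_yz : y * z = b * x
  span : ∀ α : K, ∃ p q r s : ℚ, α = p + q * x + r * y + s * z
  indep : ∀ p q r s : ℚ, (p + q * x + r * y + s * z : K) = 0 → p = 0 ∧ q = 0 ∧ r = 0 ∧ s = 0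

namespace IsBiquadratic

section
variable {K : Type*} [Field K] [CharZero K] {m a b : ℤ} {x y z : K}

theorem swap_xy (h : IsBiquadratic m a b x y z) : IsBiquadratic m b a y x z where
  sq_x := h.sq_y
  sq_y := h.sq_x
  sq_z := by rw [h.sq_z, mul_comm]
  mul_xy := by rw [mul_comm, h.mul_xy]
  mul_xz := h.mul_yz
  mul_yz := h.mul_xz
  span α := by
    obtain ⟨p, q, r, s, e⟩ := h.span α
    exact ⟨p, r, q, s, by rw [e]; ring⟩
  indep p q r s e := by
    obtain ⟨hp, hq, hr, hs⟩ := h.indep p r q s (by rw [← e]; ring)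
    exact ⟨hp, hr, hq, hs⟩

theorem swap_yz (h : IsBiquadratic m a b x y z) : IsBiquadratic a m b x z y where
  sq_x := by rw [h.sq_x, mul_comm]
  sq_y := h.sq_z
  sq_z := h.sq_y
  mul_xy := h.mul_xz
  mul_xz := h.mul_xy
  mul_yz := by rw [mul_comm, h.mul_yz]
  span α := by
    obtain ⟨p, q, r, s, e⟩ := h.span α
    exact ⟨p, q, s, r, by rw [e]; ring⟩
  indep p q r s e := by
    obtain ⟨hp, hq, hr, hs⟩ := h.indep p q s r (by rw [← e]; ring)
    exact ⟨hp, hq, hs, hr⟩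

theorem exists_conj (h : IsBiquadratic m a b x y z) :
    ∃ σ : K ≃ₐ[ℚ] K, σ x = x ∧ σ y = -y ∧ σ z = -z := by
  choose p q r s hrep using h.span
  obtain ⟨f, hf⟩ : ∃ f : K → K, ∀ α, f α = p α + q α * x - r α * y - s α * z := ⟨_, fun _ => rfl⟩
  have key (P Q R S : ℚ) : f (P + Q * x + R * y + S * z) = P + Q * x - R * y - S * z := by
    set α : K := P + Q * x + R * y + S * z with hα
    obtain ⟨hp, hq, hr, hs⟩ := h.indep (p α - P) (q α - Q) (r α - R) (s α - S) (by
      push_cast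
      linear_combination hα - hrep α)
    rw [hf, sub_eq_zero.mp hp, sub_eq_zero.mp hq, sub_eq_zero.mp hr, sub_eq_zero.mp hs]
  have hadd (α β : K) : f (α + β) = f α + f β := by
    have e : α + β = ((p α + p β : ℚ) : K) + ((q α + q β : ℚ) : K) * x
        + ((r α + r β : ℚ) : K) * y + ((s α + s β : ℚ) : K) * z := by
      push_cast
      linear_combination hrep α + hrep β
    rw [e, key, hf α, hf β]
    push_cast
    ring
  have hmul (α β : K) : f (α * β) = f α * f β := by
    have e : α * β =
        ((p α * p β + m * a * q α * q β + m * b * r α * r β + a * b * s α * s β : ℚ) : K)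
        + ((p α * q β + q α * p β + b * (r α * s β + s α * r β) : ℚ) : K) * x
        + ((p α * r β + r α * p β + a * (q α * s β + s α * q β) : ℚ) : K) * y
        + ((p α * s β + s α * p β + m * (q α * r β + r α * q β) : ℚ) : K) * z := by
      conv_lhs => rw [hrep α, hrep β]
      push_cast
      linear_combination (q α * q β : K) * h.sq_x + (r α * r β : K) * h.sq_y
        + (s α * s β : K) * h.sq_z + (q α * r β + r α * q β : K) * h.mul_xy
        + (q α * s β + s α * q β : K) * h.mul_xz + (r α * s β + s α * r β : K) * h.mul_yz
    rw [e, key, hf α, hf β]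
    push_cast
    linear_combination -(q α * q β : K) * h.sq_x - (r α * r β : K) * h.sq_y
      - (s α * s β : K) * h.sq_z + (q α * r β + r α * q β : K) * h.mul_xy
      + (q α * s β + s α * q β : K) * h.mul_xz - (r α * s β + s α * r β : K) * h.mul_yz
  have hinv (α : K) : f (f α) = α := by
    have e : f α = (p α : K) + (q α : K) * x + ((-r α : ℚ) : K) * y + ((-s α : ℚ) : K) * z := by
      rw [hf]
      push_cast
      ring
    rw [e, key]
    conv_rhs => rw [hrep α]
    push_cast
    ring
  let g : K ≃+* K :=
    { toFun := f, invFun := f, left_inv := hinv, right_inv := hinv, map_mul' := hmul,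
      map_add' := hadd }
  refine ⟨AlgEquiv.ofRingEquiv (f := g) fun c => by simp, ?_, ?_, ?_⟩
  · simpa [g] using key 0 1 0 0
  · simpa [g] using key 0 0 1 0
  · simpa [g] using key 0 0 0 1

theorem exists_int_of_isIntegral_quadratic (h : IsBiquadratic m a b x y z)
    (hn : Squarefree (m * a)) {p q : ℚ} (hi : IsIntegral ℤ (p + q * x : K)) :
    ∃ A B N : ℤ, 2 * p = A ∧ 2 * q = B ∧ A ^ 2 - m * a * B ^ 2 = 4 * N := by
  obtain ⟨σ, -, hσ, -⟩ := h.swap_xy.exists_conj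
  have hi' : IsIntegral ℤ (p - q * x : K) := by
    have hm := map_isIntegral_int σ hi
    rwa [map_add, map_mul, map_ratCast, map_ratCast, hσ, mul_neg, ← sub_eq_add_neg] at hm
  obtain ⟨A, hA⟩ := exists_int_of_isIntegral_ratCast (K := K) (r := 2 * p) (by
    have e : ((2 * p : ℚ) : K) = (p + q * x) + (p - q * x) := by
      push_cast
      ring
    exact e ▸ hi.add hi')
  obtain ⟨N, hN⟩ := exists_int_of_isIntegral_ratCast (K := K) (r := p ^ 2 - m * a * q ^ 2) (by
    have e : ((p ^ 2 - m * a * q ^ 2 : ℚ) : K) = (p + q * x) * (p - q * x) := by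
      push_cast
      linear_combination (q ^ 2 : K) * h.sq_x
    exact e ▸ hi.mul hi')
  obtain ⟨B, hB⟩ := hn.exists_int_of_mul_sq (t := 2 * q) (k := A ^ 2 - 4 * N) (by
    push_cast
    rw [← hA, ← hN]
    ring)
  refine ⟨A, B, N, hA, hB, ?_⟩
  have hQ : (A : ℚ) ^ 2 - m * a * B ^ 2 = 4 * N := by
    rw [← hA, ← hB, ← hN]
    ring
  exact_mod_cast hQ

theorem exists_int_trace (h : IsBiquadratic m a b x y z) (hn : Squarefree (m * a))
    {p q r s : ℚ} (hi : IsIntegral ℤ (p + q * x + r * y + s * z : K)) :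
    ∃ A B N : ℤ, 4 * p = A ∧ 4 * q = B ∧ A ^ 2 - m * a * B ^ 2 = 4 * N := by
  obtain ⟨σ, hx, hy, hz⟩ := h.exists_conj
  have hi' := map_isIntegral_int σ hi
  obtain ⟨A, B, N, hA, hB, hN⟩ :=
    h.exists_int_of_isIntegral_quadratic hn (p := 2 * p) (q := 2 * q) (by
      have e : ((2 * p : ℚ) + (2 * q : ℚ) * x : K) = (p + q * x + r * y + s * z) +
          σ (p + q * x + r * y + s * z) := by
        simp only [map_add, map_mul, map_ratCast, hx, hy, hz]
        push_cast
        ring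
      exact e ▸ hi.add hi')
  exact ⟨A, B, N, by rw [← hA]; ring, by rw [← hB]; ring, hN⟩

theorem exists_int_norm (h : IsBiquadratic m a b x y z) (hn : Squarefree (m * a))
    {p q r s : ℚ} (hi : IsIntegral ℤ (p + q * x + r * y + s * z : K)) {A B C D : ℤ}
    (hA : 4 * p = A) (hB : 4 * q = B) (hC : 4 * r = C) (hD : 4 * s = D) :
    ∃ E F N : ℤ, A ^ 2 + m * a * B ^ 2 - m * b * C ^ 2 - a * b * D ^ 2 = 8 * E ∧
      A * B - b * C * D = 4 * F ∧ E ^ 2 - m * a * F ^ 2 = 4 * N := by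
  obtain ⟨σ, hx, hy, hz⟩ := h.exists_conj
  have hi' := map_isIntegral_int σ hi
  obtain ⟨E, F, N, hE, hF, hN⟩ := h.exists_int_of_isIntegral_quadratic hn
    (p := p ^ 2 + m * a * q ^ 2 - m * b * r ^ 2 - a * b * s ^ 2)
    (q := 2 * (p * q - b * r * s)) (by
      have e : ((p ^ 2 + m * a * q ^ 2 - m * b * r ^ 2 - a * b * s ^ 2 : ℚ) +
          (2 * (p * q - b * r * s) : ℚ) * x : K) = (p + q * x + r * y + s * z) *
          σ (p + q * x + r * y + s * z) := by
        simp only [map_add, map_mul, map_ratCast, hx, hy, hz]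
        push_cast
        linear_combination -(q ^ 2 : K) * h.sq_x + (r ^ 2 : K) * h.sq_y + (s ^ 2 : K) * h.sq_z
          + (2 * r * s : K) * h.mul_yz
      exact e ▸ hi.mul hi')
  refine ⟨E, F, N, ?_, ?_, hN⟩
  · have hQ : (A : ℚ) ^ 2 + m * a * B ^ 2 - m * b * C ^ 2 - a * b * D ^ 2 = 8 * E := by
      rw [← hA, ← hB, ← hC, ← hD, ← hE]
      ring
    exact_mod_cast hQ
  · have hQ : (A : ℚ) * B - b * C * D = 4 * F := by
      rw [← hA, ← hB, ← hC, ← hD, ← hF]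
      ring
    exact_mod_cast hQ

end

theorem exists_int_coords {K : Type*} [Field K] [CharZero K] {m a b : ℤ} {x y z : K}
    (h : IsBiquadratic m a b x y z) (hma : Squarefree (m * a)) (hmb : Squarefree (m * b))
    (hab : Squarefree (a * b)) {α : K} (hi : IsIntegral ℤ α) :
    ∃ A B C D : ℤ, 4 * α = A + B * x + C * y + D * z ∧
      (∃ N, A ^ 2 - m * a * B ^ 2 = 4 * N) ∧ (∃ N, A ^ 2 - m * b * C ^ 2 = 4 * N) ∧
      (∃ N, A ^ 2 - a * b * D ^ 2 = 4 * N) ∧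
      (∃ E F, A ^ 2 + m * a * B ^ 2 - m * b * C ^ 2 - a * b * D ^ 2 = 8 * E ∧
        A * B - b * C * D = 4 * F) ∧
      ∃ E F N, A ^ 2 + a * b * D ^ 2 - a * m * B ^ 2 - b * m * C ^ 2 = 8 * E ∧
        A * D - m * B * C = 4 * F ∧ E ^ 2 - a * b * F ^ 2 = 4 * N := by
  obtain ⟨p, q, r, s, rfl⟩ := h.span α
  have hz := h.swap_yz.swap_xy
  have hiy : IsIntegral ℤ (p + r * y + q * x + s * z : K) := by
    rwa [add_right_comm (p : K)]
  have hiz : IsIntegral ℤ (p + s * z + q * x + r * y : K) := by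
    rwa [add_right_comm (p : K), add_right_comm ((p : K) + _)]
  obtain ⟨A, B, N₁, hA, hB, hN₁⟩ := h.exists_int_trace hma hi
  obtain ⟨A₂, C, N₂, hA₂, hC, hN₂⟩ := h.swap_xy.exists_int_trace hmb hiy
  obtain ⟨A₃, D, N₃, hA₃, hD, hN₃⟩ := hz.exists_int_trace hab hiz
  obtain rfl : A = A₂ := by exact_mod_cast hA.symm.trans hA₂
  obtain rfl : A = A₃ := by exact_mod_cast hA.symm.trans hA₃
  obtain ⟨E, F, -, hE, hF, -⟩ := h.exists_int_norm hma hi hA hB hC hD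
  refine ⟨A, B, C, D, ?_, ⟨N₁, hN₁⟩, ⟨N₂, hN₂⟩, ⟨N₃, hN₃⟩, ⟨E, F, hE, hF⟩,
    hz.exists_int_norm hab hiz hA hD hB hC⟩
  have hA' : (4 * p : K) = A := by exact_mod_cast congrArg (Rat.cast : ℚ → K) hA
  have hB' : (4 * q : K) = B := by exact_mod_cast congrArg (Rat.cast : ℚ → K) hB
  have hC' : (4 * r : K) = C := by exact_mod_cast congrArg (Rat.cast : ℚ → K) hC
  have hD' : (4 * s : K) = D := by exact_mod_cast congrArg (Rat.cast : ℚ → K) hD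
  linear_combination hA' + x * hB' + y * hC' + z * hD'

theorem isIntegral_half_one_add {K : Type*} [Field K] [CharZero K] {n : ℤ} {t : K}
    (hn : n % 4 = 1) (ht : t ^ 2 = n) : IsIntegral ℤ ((1 + t) / 2) := by
  obtain ⟨k, rfl⟩ : ∃ k, n = 4 * k + 1 := ⟨n / 4, by omega⟩
  refine ⟨Polynomial.X ^ 2 - (Polynomial.X + Polynomial.C k),
    Polynomial.monic_X_pow_sub (by compute_degree!), ?_⟩
  push_cast at ht
  simp only [Polynomial.eval₂_sub, Polynomial.eval₂_add, Polynomial.eval₂_pow, Polynomial.eval₂_X,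
    Polynomial.eval₂_C, algebraMap_int_eq]
  rw [eq_intCast]
  linear_combination ht / 4

variable {K : Type*} [Field K] [NumberField K] {m a b : ℤ} {x y z : K}

theorem trace_eq_zero (h : IsBiquadratic m a b x y z) : Algebra.trace ℚ K x = 0 := by
  obtain ⟨σ, -, hσ, -⟩ := h.swap_xy.exists_conj
  have ht := Algebra.trace_eq_of_algEquiv σ x
  rw [hσ, map_neg] at ht
  linarith

theorem finrank_eq_four (h : IsBiquadratic m a b x y z) : Module.finrank ℚ K = 4 := by
  have hli : LinearIndependent ℚ ![1, x, y, z] := by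
    rw [Fintype.linearIndependent_iff]
    intro g hg
    simp only [Fin.sum_univ_four, Rat.smul_def] at hg
    obtain ⟨h0, h1, h2, h3⟩ := h.indep (g 0) (g 1) (g 2) (g 3) (by simpa using hg)
    intro i
    fin_cases i <;> assumption
  have hsp : ⊤ ≤ Submodule.span ℚ (Set.range ![1, x, y, z]) := by
    intro α _
    obtain ⟨p, q, r, s, rfl⟩ := h.span α
    rw [Submodule.mem_span_range_iff_exists_fun]
    exact ⟨![p, q, r, s], by simp [Fin.sum_univ_four, Rat.smul_def]⟩
  simpa using Module.finrank_eq_card_basis (Module.Basis.mk hli hsp)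

theorem discr_one_x_y_z (h : IsBiquadratic m a b x y z) :
    Algebra.discr ℚ ![1, x, y, z] = 256 * m ^ 2 * a ^ 2 * b ^ 2 := by
  have hc (q : ℚ) : Algebra.trace ℚ K (q : K) = 4 * q := by
    have e := Algebra.trace_algebraMap (S := K) q
    rw [h.finrank_eq_four, eq_ratCast] at e
    simpa using e
  have hm (q : ℚ) {t : K} (ht : Algebra.trace ℚ K t = 0) : Algebra.trace ℚ K (q * t) = 0 := by
    rw [← Rat.smul_def, map_smul, ht, smul_zero]
  have tx := h.trace_eq_zero
  have ty := h.swap_xy.trace_eq_zero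
  have tz := h.swap_yz.swap_xy.trace_eq_zero
  have t1 : Algebra.trace ℚ K 1 = 4 := by simpa using hc 1
  have txx : Algebra.trace ℚ K (x * x) = 4 * (m * a) := by
    rw [← sq, h.sq_x]; exact_mod_cast hc (m * a)
  have tyy : Algebra.trace ℚ K (y * y) = 4 * (m * b) := by
    rw [← sq, h.sq_y]; exact_mod_cast hc (m * b)
  have tzz : Algebra.trace ℚ K (z * z) = 4 * (a * b) := by
    rw [← sq, h.sq_z]; exact_mod_cast hc (a * b)
  have txy : Algebra.trace ℚ K (x * y) = 0 := by
    rw [h.mul_xy]; exact_mod_cast hm m tz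
  have txz : Algebra.trace ℚ K (x * z) = 0 := by
    rw [h.mul_xz]; exact_mod_cast hm a ty
  have tyz : Algebra.trace ℚ K (y * z) = 0 := by
    rw [h.mul_yz]; exact_mod_cast hm b tx
  have hM : Algebra.traceMatrix ℚ ![1, x, y, z] =
      Matrix.diagonal (![4, 4 * (m * a), 4 * (m * b), 4 * (a * b)] : Fin 4 → ℚ) := by
    ext i j
    fin_cases i <;> fin_cases j <;>
      simp [Algebra.traceMatrix_apply, Algebra.traceForm_apply, t1, tx, ty, tz, txx, tyy, tzz,
        txy, txz, tyz, mul_comm y x, mul_comm z x, mul_comm z y]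
  rw [Algebra.discr_def, hM, Matrix.det_diagonal]
  simp [Fin.prod_univ_four]
  ring

theorem discr_eq_of_matrix (h : IsBiquadratic m a b x y z) (hm : m ≠ 0) (ha : a ≠ 0) (hb : b ≠ 0)
    (v : Fin 4 → K) (P : Matrix (Fin 4) (Fin 4) ℚ)
    (hP : v = Matrix.vecMul ![1, x, y, z] (P.map (algebraMap ℚ K))) (hd : P.det ≠ 0)
    (hv : ∀ i, IsIntegral ℤ (v i))
    (hsp : ∀ α : K, IsIntegral ℤ α → ∃ c : Fin 4 → ℤ, α = ∑ i, c i • v i) :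
    (NumberField.discr K : ℚ) = P.det ^ 2 * (256 * m ^ 2 * a ^ 2 * b ^ 2) := by
  have e : Algebra.discr ℚ v = P.det ^ 2 * (256 * m ^ 2 * a ^ 2 * b ^ 2) := by
    rw [hP, Algebra.discr_of_matrix_vecMul, h.discr_one_x_y_z]
  rw [← e]
  refine discr_eq_of_span v hv hsp ?_
  rw [e]
  have hm' : (m : ℚ) ≠ 0 := by exact_mod_cast hm
  have ha' : (a : ℚ) ≠ 0 := by exact_mod_cast ha
  have hb' : (b : ℚ) ≠ 0 := by exact_mod_cast hb
  positivity

theorem isIntegral_x (h : IsBiquadratic m a b x y z) : IsIntegral ℤ x := by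
  refine IsIntegral.of_pow (n := 2) two_pos ?_
  rw [h.sq_x]
  exact_mod_cast isIntegral_algebraMap (R := ℤ) (A := K) (x := m * a)

theorem discr_of_all_one_mod_four (h : IsBiquadratic m a b x y z) (hma : Squarefree (m * a))
    (hmb : Squarefree (m * b)) (hab : Squarefree (a * b)) (h₁ : m * a % 4 = 1)
    (h₂ : m * b % 4 = 1) (h₃ : a * b % 4 = 1) :
    NumberField.discr K = m ^ 2 * a ^ 2 * b ^ 2 := by
  have hx := isIntegral_half_one_add h₁ (t := x) (by rw [h.sq_x]; push_cast; rfl)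
  have hy := isIntegral_half_one_add h₂ (t := y) (by rw [h.sq_y]; push_cast; rfl)
  have hz := isIntegral_half_one_add h₃ (t := z) (by rw [h.sq_z]; push_cast; rfl)
  have hdet : (!![1, 1/2, 1/2, 1/4; 0, 1/2, 0, 1/4; 0, 0, 1/2, a/4; 0, 0, 0, 1/4] :
      Matrix (Fin 4) (Fin 4) ℚ).det = 1 / 16 := by
    simp [Matrix.det_succ_row_zero, Fin.sum_univ_succ, Fin.succAbove]
    norm_num
  have hd := h.discr_eq_of_matrix (left_ne_zero_of_mul hma.ne_zero)
    (right_ne_zero_of_mul hma.ne_zero) (right_ne_zero_of_mul hmb.ne_zero)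
    ![1, (1 + x) / 2, (1 + y) / 2, (1 + x) / 2 * ((1 + z) / 2)]
    !![1, 1/2, 1/2, 1/4; 0, 1/2, 0, 1/4; 0, 0, 1/2, a/4; 0, 0, 0, 1/4] (by
      ext i
      fin_cases i <;> simp [Matrix.vecMul, dotProduct, Fin.sum_univ_four]
      · ring
      · ring
      · linear_combination h.mul_xz / 4) (by rw [hdet]; norm_num) (by
      intro i
      fin_cases i
      exacts [isIntegral_one, hx, hy, hx.mul hz]) (by
      intro α hα
      obtain ⟨A, B, C, D, e, ⟨N₁, hN₁⟩, ⟨N₂, hN₂⟩, ⟨N₃, hN₃⟩, ⟨E, F, hE, hF⟩, -⟩ :=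
        h.exists_int_coords hma hmb hab hα
      obtain ⟨⟨c₁, h1⟩, ⟨c₂, h2⟩, ⟨c₀, h0⟩⟩ :=
        congr_of_all_one_mod_four h₁ h₂ h₃ hN₁ hN₂ hN₃ hE hF
      refine ⟨![c₀, c₁, c₂, D], ?_⟩
      have h0' : (A - B - C + a * D : K) = 4 * c₀ := by exact_mod_cast congrArg Int.cast h0
      have h1' : (B - D : K) = 2 * c₁ := by exact_mod_cast congrArg Int.cast h1
      have h2' : (C - a * D : K) = 2 * c₂ := by exact_mod_cast congrArg Int.cast h2
      simp [Fin.sum_univ_four]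
      linear_combination e / 4 + h0' / 4 + (1 + x) / 4 * h1' + (1 + y) / 4 * h2'
        - D / 4 * h.mul_xz)
  rw [hdet] at hd
  have : (NumberField.discr K : ℚ) = m ^ 2 * a ^ 2 * b ^ 2 := by
    rw [hd]
    ring
  exact_mod_cast this

theorem discr_of_one_mod_four (h : IsBiquadratic m a b x y z) (hma : Squarefree (m * a))
    (hmb : Squarefree (m * b)) (hab : Squarefree (a * b))
    (h₁ : m * a % 4 = 2 ∨ m * a % 4 = 3) (h₂ : m * b % 4 = 2 ∨ m * b % 4 = 3)
    (h₃ : a * b % 4 = 1) :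
    NumberField.discr K = 4 ^ 2 * m ^ 2 * a ^ 2 * b ^ 2 := by
  have hz := isIntegral_half_one_add h₃ (t := z) (by rw [h.sq_z]; push_cast; rfl)
  have hxy : IsIntegral ℤ ((x + y) / 2) := by
    obtain ⟨⟨i, hi⟩, l, hl⟩ := Int.odd_mul_mod_four (a := a) (b := b) (by omega)
    obtain ⟨k, hk⟩ : ∃ k, a * b = 4 * k + 1 := ⟨a * b / 4, by omega⟩
    rw [hk] at hl
    have hi' : (a : K) = 2 * i + 1 := by exact_mod_cast congrArg Int.cast hi
    have hl' : (b : K) = a * (4 * k + 1) + 4 * l := by exact_mod_cast congrArg Int.cast hl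
    refine IsIntegral.of_pow (n := 2) two_pos ?_
    have e : ((x + y) / 2) ^ 2 = (m : K) * ((1 + z) / 2 + (i + a * k + l : ℤ)) := by
      push_cast
      linear_combination h.sq_x / 4 + h.sq_y / 4 + h.mul_xy / 2 + m / 2 * hi' + m / 4 * hl'
    rw [e]
    exact (isIntegral_algebraMap (R := ℤ) (x := m)).mul
      (hz.add (isIntegral_algebraMap (R := ℤ) (x := i + a * k + l)))
  have hdet : (!![1, 0, 0, 1/2; 0, 1, 1/2, 0; 0, 0, 1/2, 0; 0, 0, 0, 1/2] :
      Matrix (Fin 4) (Fin 4) ℚ).det = 1 / 4 := by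
    simp [Matrix.det_succ_row_zero, Fin.sum_univ_succ, Fin.succAbove]
    norm_num
  have hd := h.discr_eq_of_matrix (left_ne_zero_of_mul hma.ne_zero)
    (right_ne_zero_of_mul hma.ne_zero) (right_ne_zero_of_mul hmb.ne_zero)
    ![1, x, (x + y) / 2, (1 + z) / 2]
    !![1, 0, 0, 1/2; 0, 1, 1/2, 0; 0, 0, 1/2, 0; 0, 0, 0, 1/2] (by
      ext i
      fin_cases i <;> simp [Matrix.vecMul, dotProduct, Fin.sum_univ_four]
      · ring
      · ring) (by rw [hdet]; norm_num) (by
      intro i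
      fin_cases i
      exacts [isIntegral_one, h.isIntegral_x, hxy, hz]) (by
      intro α hα
      obtain ⟨A, B, C, D, e, ⟨N₁, hN₁⟩, ⟨N₂, hN₂⟩, ⟨N₃, hN₃⟩, -, E, F, N, hE, hF, hN⟩ :=
        h.exists_int_coords hma hmb hab hα
      obtain ⟨⟨A, rfl⟩, ⟨B, rfl⟩⟩ := even_of_sq_sub_mul_sq h₁ hN₁
      obtain ⟨-, ⟨C, rfl⟩⟩ := even_of_sq_sub_mul_sq h₂ hN₂
      obtain ⟨D, rfl⟩ : 2 ∣ D := by
        have := two_dvd_sub_of_sq_sub_mul_sq (by omega) hN₃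
        omega
      obtain ⟨⟨c₀, h0⟩, ⟨c₁, h1⟩⟩ := congr_of_one_mod_four (m := m) (A := A) (B := B) (C := C)
        (D := D) (E := E) (F := F) h₁ h₃ (by linarith) (by linarith) hN
      refine ⟨![c₀, c₁, C, D], ?_⟩
      have h0' : (A - D : K) = 2 * c₀ := by exact_mod_cast congrArg Int.cast h0
      have h1' : (B - C : K) = 2 * c₁ := by exact_mod_cast congrArg Int.cast h1
      push_cast at e
      simp [Fin.sum_univ_four]
      linear_combination e / 4 + h0' / 2 + x / 2 * h1')
  rw [hdet] at hd
  have : (NumberField.discr K : ℚ) = 4 ^ 2 * m ^ 2 * a ^ 2 * b ^ 2 := by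
    rw [hd]
    ring
  exact_mod_cast this

theorem discr_of_three_mod_four (h : IsBiquadratic m a b x y z) (hma : Squarefree (m * a))
    (hmb : Squarefree (m * b)) (hab : Squarefree (a * b)) (hm : m % 4 = 2)
    (h₃ : a * b % 4 = 3) :
    NumberField.discr K = 8 ^ 2 * m ^ 2 * a ^ 2 * b ^ 2 := by
  have hz := h.swap_yz.swap_xy.isIntegral_x
  obtain ⟨j, hj⟩ : ∃ j, m = 4 * j + 2 := ⟨m / 4, by omega⟩
  obtain ⟨⟨i, hi⟩, l, hl⟩ := Int.odd_mul_mod_four (a := a) (b := b) (by omega)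
  have hxy : IsIntegral ℤ ((x + y) / 2) := by
    obtain ⟨k, hk⟩ : ∃ k, a * b = 4 * k + 3 := ⟨a * b / 4, by omega⟩
    rw [hk] at hl
    have hj' : (m : K) = 4 * j + 2 := by exact_mod_cast congrArg Int.cast hj
    have hl' : (b : K) = a * (4 * k + 3) + 4 * l := by exact_mod_cast congrArg Int.cast hl
    refine IsIntegral.of_pow (n := 2) two_pos ?_
    have e : ((x + y) / 2) ^ 2 =
        ((2 * j + 1 : ℤ) : K) * (z + (2 * a + 2 * a * k + 2 * l : ℤ)) := by
      push_cast
      linear_combination h.sq_x / 4 + h.sq_y / 4 + h.mul_xy / 2 + (a + b + 2 * z) / 4 * hj' +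
        (2 * j + 1) / 2 * hl'
    rw [e]
    exact (isIntegral_algebraMap (R := ℤ) (x := 2 * j + 1)).mul
      (hz.add (isIntegral_algebraMap (R := ℤ) (x := 2 * a + 2 * a * k + 2 * l)))
  have hdet : (!![1, 0, 0, 0; 0, 1, 1/2, 0; 0, 0, 1/2, 0; 0, 0, 0, 1] :
      Matrix (Fin 4) (Fin 4) ℚ).det = 1 / 2 := by
    simp [Matrix.det_succ_row_zero, Fin.sum_univ_succ, Fin.succAbove]
  have h₁ : m * a % 4 = 2 := by
    rw [hj, hi, show (4 * j + 2) * (2 * i + 1) = 4 * (2 * j * i + j + i) + 2 by ring]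
    omega
  have h₂ : m * b % 4 = 2 := by
    obtain ⟨⟨i, hi⟩, -⟩ := Int.odd_mul_mod_four (a := b) (b := a) (by rw [mul_comm]; omega)
    rw [hj, hi, show (4 * j + 2) * (2 * i + 1) = 4 * (2 * j * i + j + i) + 2 by ring]
    omega
  have hd := h.discr_eq_of_matrix (left_ne_zero_of_mul hma.ne_zero)
    (right_ne_zero_of_mul hma.ne_zero) (right_ne_zero_of_mul hmb.ne_zero)
    ![1, x, (x + y) / 2, z]
    !![1, 0, 0, 0; 0, 1, 1/2, 0; 0, 0, 1/2, 0; 0, 0, 0, 1] (by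
      ext i
      fin_cases i <;> simp [Matrix.vecMul, dotProduct, Fin.sum_univ_four]
      ring) (by rw [hdet]; norm_num) (by
      intro i
      fin_cases i
      exacts [isIntegral_one, h.isIntegral_x, hxy, hz]) (by
      intro α hα
      obtain ⟨A, B, C, D, e, ⟨N₁, hN₁⟩, ⟨N₂, hN₂⟩, ⟨N₃, hN₃⟩, -, E, F, N, hE, hF, hN⟩ :=
        h.exists_int_coords hma hmb hab hα
      obtain ⟨⟨A, rfl⟩, ⟨B, rfl⟩⟩ := even_of_sq_sub_mul_sq (.inl h₁) hN₁
      obtain ⟨-, ⟨C, rfl⟩⟩ := even_of_sq_sub_mul_sq (.inl h₂) hN₂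
      obtain ⟨-, ⟨D, rfl⟩⟩ := even_of_sq_sub_mul_sq (.inr h₃) hN₃
      obtain ⟨⟨A, rfl⟩, ⟨D, rfl⟩, ⟨c₁, h1⟩⟩ := congr_of_three_mod_four (m := m) (A := A) (B := B)
        (C := C) (D := D) (E := E) (F := F) hm h₃ (by linarith) (by linarith) hN
      refine ⟨![A, c₁, C, D], ?_⟩
      have h1' : (B - C : K) = 2 * c₁ := by exact_mod_cast congrArg Int.cast h1
      push_cast at e
      simp [Fin.sum_univ_four]
      linear_combination e / 4 + x / 2 * h1')
  rw [hdet] at hd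
  have : (NumberField.discr K : ℚ) = 8 ^ 2 * m ^ 2 * a ^ 2 * b ^ 2 := by
    rw [hd]
    ring
  exact_mod_cast this

end IsBiquadratic

theorem exists_rat_coords_of_mem_adjoin {L : Type*} [Field L] [CharZero L] {m a b : ℤ}
    {x y z : L} (sq_x : x ^ 2 = m * a) (sq_y : y ^ 2 = m * b) (sq_z : z ^ 2 = a * b)
    (mul_xy : x * y = m * z) (mul_xz : x * z = a * y) (mul_yz : y * z = b * x) {α : L}
    (hα : α ∈ Algebra.adjoin ℚ {x, y}) : ∃ p q r s : ℚ, α = p + q * x + r * y + s * z := by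
  induction hα using Algebra.adjoin_induction with
  | mem t ht =>
    rcases ht with rfl | rfl
    · exact ⟨0, 1, 0, 0, by simp⟩
    · exact ⟨0, 0, 1, 0, by simp⟩
  | algebraMap c => exact ⟨c, 0, 0, 0, by simp⟩
  | add α β _ _ hα hβ =>
    obtain ⟨p, q, r, s, rfl⟩ := hα
    obtain ⟨p', q', r', s', rfl⟩ := hβ
    refine ⟨p + p', q + q', r + r', s + s', ?_⟩
    push_cast
    ring
  | mul α β _ _ hα hβ =>
    obtain ⟨p, q, r, s, rfl⟩ := hα
    obtain ⟨p', q', r', s', rfl⟩ := hβ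
    refine ⟨p * p' + m * a * q * q' + m * b * r * r' + a * b * s * s',
      p * q' + q * p' + b * (r * s' + s * r'), p * r' + r * p' + a * (q * s' + s * q'),
      p * s' + s * p' + m * (q * r' + r * q'), ?_⟩
    push_cast
    linear_combination (q * q' : L) * sq_x + (r * r' : L) * sq_y + (s * s' : L) * sq_z
      + (q * r' + r * q' : L) * mul_xy + (q * s' + s * q' : L) * mul_xz
      + (r * s' + s * r' : L) * mul_yz

theorem eq_zero_of_add_mul_sqrt_eq_zero {L : Type*} [Field L] [CharZero L] {n : ℤ} {x : L}
    (hn : Squarefree n) (h1 : n ≠ 1) (hx : x ^ 2 = n) {p q : ℚ} (h : (p + q * x : L) = 0) :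
    p = 0 ∧ q = 0 := by
  refine rat_of_sq_eq_mul_sq hn h1 ?_
  have e : (p ^ 2 : L) = n * q ^ 2 := by linear_combination (p - q * x : L) * h + (q ^ 2 : L) * hx
  exact_mod_cast e

theorem eq_zero_of_biquadratic_eq_zero {L : Type*} [Field L] [CharZero L] {m a b : ℤ} {x y z : L}
    (hma : Squarefree (m * a)) (hmb : Squarefree (m * b)) (hab : Squarefree (a * b))
    (hma1 : m * a ≠ 1) (hmb1 : m * b ≠ 1) (hab1 : a * b ≠ 1)
    (sq_x : x ^ 2 = m * a) (sq_y : y ^ 2 = m * b) (sq_z : z ^ 2 = a * b) (mul_yz : y * z = b * x)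
    {p q r s : ℚ} (h : (p + q * x + r * y + s * z : L) = 0) : p = 0 ∧ q = 0 ∧ r = 0 ∧ s = 0 := by
  have hm : (m : ℚ) ≠ 0 := by exact_mod_cast left_ne_zero_of_mul hma.ne_zero
  have ha : (a : ℚ) ≠ 0 := by exact_mod_cast right_ne_zero_of_mul hma.ne_zero
  have hQ : ((p ^ 2 + m * a * q ^ 2 - m * b * r ^ 2 - a * b * s ^ 2 : ℚ) : L)
      + ((2 * (p * q - b * r * s) : ℚ) : L) * x = 0 := by
    push_cast
    linear_combination (p + q * x - r * y - s * z : L) * h - (q ^ 2 : L) * sq_x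
      + (r ^ 2 : L) * sq_y + (s ^ 2 : L) * sq_z + (2 * r * s : L) * mul_yz
  obtain ⟨h₁, h₂⟩ := eq_zero_of_add_mul_sqrt_eq_zero hma hma1 (by rw [sq_x]; push_cast; rfl) hQ
  have hprod : (p ^ 2 - m * b * r ^ 2) * (p ^ 2 - a * b * s ^ 2) = 0 := by
    linear_combination p ^ 2 * h₁ - (m * a / 2 * (p * q + b * r * s)) * h₂
  rcases mul_eq_zero.mp hprod with h₀ | h₀
  · obtain ⟨rfl, rfl⟩ := rat_of_sq_eq_mul_sq hmb hmb1 (u := p) (v := r) (by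
      push_cast
      linear_combination h₀)
    obtain ⟨hq, rfl⟩ := rat_of_sq_eq_mul_sq hmb hmb1 (u := m * q) (v := s) (by
      push_cast
      refine mul_left_cancel₀ ha ?_
      linear_combination m * h₁)
    exact ⟨rfl, (mul_eq_zero.mp hq).resolve_left hm, rfl, rfl⟩
  · obtain ⟨rfl, rfl⟩ := rat_of_sq_eq_mul_sq hab hab1 (u := p) (v := s) (by
      push_cast
      linear_combination h₀)
    obtain ⟨hq, rfl⟩ := rat_of_sq_eq_mul_sq hab hab1 (u := a * q) (v := r) (by
      push_cast
      refine mul_left_cancel₀ hm ?_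
      linear_combination a * h₁)
    exact ⟨rfl, (mul_eq_zero.mp hq).resolve_left ha, rfl, rfl⟩

theorem exists_isBiquadratic_adjoin {L : Type*} [Field L] [CharZero L] {m a b : ℤ} {x y : L}
    (hma : Squarefree (m * a)) (hmb : Squarefree (m * b)) (hab : Squarefree (a * b))
    (hma1 : m * a ≠ 1) (hmb1 : m * b ≠ 1) (hab1 : a * b ≠ 1)
    (sq_x : x ^ 2 = m * a) (sq_y : y ^ 2 = m * b) :
    ∃ x' y' z' : IntermediateField.adjoin ℚ {x, y}, IsBiquadratic m a b x' y' z' := by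
  have hm : (m : L) ≠ 0 := by exact_mod_cast left_ne_zero_of_mul hma.ne_zero
  have hx : x ∈ IntermediateField.adjoin ℚ {x, y} :=
    IntermediateField.subset_adjoin _ _ (by simp)
  have hy : y ∈ IntermediateField.adjoin ℚ {x, y} :=
    IntermediateField.subset_adjoin _ _ (by simp)
  have hz : x * y / m ∈ IntermediateField.adjoin ℚ {x, y} :=
    div_mem (mul_mem hx hy) (intCast_mem _ m)
  have sq_z : (x * y / m) ^ 2 = a * b := by
    field_simp
    linear_combination y ^ 2 * sq_x + (m * a : L) * sq_y
  have mul_xy : x * y = m * (x * y / m) := by field_simp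
  have mul_xz : x * (x * y / m) = a * y := by
    field_simp
    linear_combination y * sq_x
  have mul_yz : y * (x * y / m) = b * x := by
    field_simp
    linear_combination x * sq_y
  have hint {t : L} {n : ℤ} (ht : t ^ 2 = n) : IsAlgebraic ℚ t := by
    refine IsAlgebraic.of_pow two_pos ?_
    rw [ht]
    exact isAlgebraic_intCast n
  refine ⟨⟨x, hx⟩, ⟨y, hy⟩, ⟨x * y / m, hz⟩, ⟨Subtype.ext ?_, Subtype.ext ?_, Subtype.ext ?_,
    Subtype.ext ?_, Subtype.ext ?_, Subtype.ext ?_, fun α => ?_, fun p q r s h => ?_⟩⟩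
  · simpa using sq_x
  · simpa using sq_y
  · simpa using sq_z
  · simpa using mul_xy
  · simpa using mul_xz
  · simpa using mul_yz
  · have hα : (α : L) ∈ (IntermediateField.adjoin ℚ {x, y}).toSubalgebra := α.2
    rw [IntermediateField.adjoin_toSubalgebra_of_isAlgebraic (by
      rintro t (rfl | rfl)
      · exact hint (n := m * a) (by rw [sq_x]; push_cast; rfl)
      · exact hint (n := m * b) (by rw [sq_y]; push_cast; rfl))] at hα
    obtain ⟨p, q, r, s, e⟩ :=
      exists_rat_coords_of_mem_adjoin sq_x sq_y sq_z mul_xy mul_xz mul_yz hα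
    exact ⟨p, q, r, s, Subtype.ext (by simpa using e)⟩
  · exact eq_zero_of_biquadratic_eq_zero hma hmb hab hma1 hmb1 hab1 sq_x sq_y sq_z mul_yz
      (by simpa using congrArg Subtype.val h)

theorem Squarefree.emod_four {n : ℤ} (hn : Squarefree n) : n % 4 = 1 ∨ n % 4 = 2 ∨ n % 4 = 3 := by
  have h : n % 4 ≠ 0 := by
    intro h
    have h2 : IsUnit (2 : ℤ) := hn 2 ⟨n / 4, by omega⟩
    exact absurd h2 (by decide)
  omega

theorem not_two_mod_four_of_isCoprime {m n : ℤ} (h : IsCoprime m n) :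
    ¬ (m % 4 = 2 ∧ n % 4 = 2) := by
  rintro ⟨hm, hn⟩
  have h2 : IsUnit (2 : ℤ) := h.isUnit_of_dvd' (by omega) (by omega)
  exact absurd h2 (by decide)

theorem two_mod_four_and_three_mod_four {m a b : ℤ} (hm : m % 4 = 1 ∨ m % 4 = 2 ∨ m % 4 = 3)
    (ha : a % 4 = 1 ∨ a % 4 = 2 ∨ a % 4 = 3) (hb : b % 4 = 1 ∨ b % 4 = 2 ∨ b % 4 = 3)
    (hma : ¬ (m % 4 = 2 ∧ a % 4 = 2)) (hmb : ¬ (m % 4 = 2 ∧ b % 4 = 2))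
    (hab : ¬ (a % 4 = 2 ∧ b % 4 = 2)) (h₁ : ¬ (m * a % 4 = 1 ∧ m * b % 4 = 1 ∧ a * b % 4 = 1))
    (h₂ : ¬ ((m * a % 4 = 1 ∧ m * b % 4 ≠ 1 ∧ a * b % 4 ≠ 1) ∨
      (m * a % 4 ≠ 1 ∧ m * b % 4 = 1 ∧ a * b % 4 ≠ 1) ∨
      (m * a % 4 ≠ 1 ∧ m * b % 4 ≠ 1 ∧ a * b % 4 = 1))) :
    (m % 4 = 2 ∧ a * b % 4 = 3) ∨ (a % 4 = 2 ∧ m * b % 4 = 3) ∨ (b % 4 = 2 ∧ m * a % 4 = 3) := by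
  rw [Int.mul_emod m a, Int.mul_emod m b, Int.mul_emod a b] at h₁ h₂ ⊢
  generalize m % 4 = i at *
  generalize a % 4 = j at *
  generalize b % 4 = k at *
  rcases hm with rfl | rfl | rfl <;> rcases ha with rfl | rfl | rfl <;>
    rcases hb with rfl | rfl | rfl <;> revert hma hmb hab h₁ h₂ <;> decide

/-- for pairwise coprime squarefree integers `m, a₁, b₁` (with the three
products `≠ 1`), the discriminant of `K = ℚ(√(m a₁), √(m b₁))` is `c² m² a₁² b₁²`, where
`c = 1` if all of `m a₁, m b₁, a₁ b₁` are `≡ 1 (mod 4)`, `c = 4` if exactly one of them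
is `≡ 1 (mod 4)`, and `c = 8` if none of them is. -/
theorem stmt_18 (m a₁ b₁ : ℤ)
    (hm : Squarefree m) (ha : Squarefree a₁) (hb : Squarefree b₁)
    (hma : IsCoprime m a₁) (hmb : IsCoprime m b₁) (hab : IsCoprime a₁ b₁)
    (h₁ : m * a₁ ≠ 1) (h₂ : m * b₁ ≠ 1) (h₃ : a₁ * b₁ ≠ 1)
    (x y : AlgebraicClosure ℚ)
    (hx : x ^ 2 = ((m * a₁ : ℤ) : AlgebraicClosure ℚ))
    (hy : y ^ 2 = ((m * b₁ : ℤ) : AlgebraicClosure ℚ)) :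
    biquadDiscr (IntermediateField.adjoin ℚ {x, y}) =
      (if m * a₁ % 4 = 1 ∧ m * b₁ % 4 = 1 ∧ a₁ * b₁ % 4 = 1 then (1 : ℤ)
       else if (m * a₁ % 4 = 1 ∧ m * b₁ % 4 ≠ 1 ∧ a₁ * b₁ % 4 ≠ 1) ∨
               (m * a₁ % 4 ≠ 1 ∧ m * b₁ % 4 = 1 ∧ a₁ * b₁ % 4 ≠ 1) ∨
               (m * a₁ % 4 ≠ 1 ∧ m * b₁ % 4 ≠ 1 ∧ a₁ * b₁ % 4 = 1) then 4
       else 8) ^ 2 * m ^ 2 * a₁ ^ 2 * b₁ ^ 2 := by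
  have sma : Squarefree (m * a₁) := squarefree_mul_iff.mpr ⟨hma.isRelPrime, hm, ha⟩
  have smb : Squarefree (m * b₁) := squarefree_mul_iff.mpr ⟨hmb.isRelPrime, hm, hb⟩
  have sab : Squarefree (a₁ * b₁) := squarefree_mul_iff.mpr ⟨hab.isRelPrime, ha, hb⟩
  obtain ⟨x', y', z', h⟩ := exists_isBiquadratic_adjoin sma smb sab h₁ h₂ h₃
    (by rw [hx]; push_cast; rfl) (by rw [hy]; push_cast; rfl)
  have hfin : FiniteDimensional ℚ (IntermediateField.adjoin ℚ {x, y}) :=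
    IntermediateField.finiteDimensional_adjoin fun t _ =>
      (AlgebraicClosure.isAlgebraic ℚ).isAlgebraic t |>.isIntegral
  rw [biquadDiscr, dif_pos hfin]
  let _ : NumberField (IntermediateField.adjoin ℚ {x, y}) := ⟨⟩
  have nma := sma.emod_four
  have nmb := smb.emod_four
  have nab := sab.emod_four
  have sba := mul_comm a₁ b₁ ▸ sab
  have sam := mul_comm m a₁ ▸ sma
  have sbm := mul_comm m b₁ ▸ smb
  split_ifs with c₁ c₂
  · refine (h.discr_of_all_one_mod_four sma smb sab c₁.1 c₁.2.1 c₁.2.2).trans (by ring)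
  · rcases c₂ with ⟨c, d, e⟩ | ⟨c, d, e⟩ | ⟨c, d, e⟩
    · refine (h.swap_xy.swap_yz.discr_of_one_mod_four sbm sba sma
        (by rw [mul_comm b₁ m]; omega) (by rw [mul_comm b₁ a₁]; omega) c).trans (by ring)
    · refine (h.swap_yz.discr_of_one_mod_four sam sab smb
        (by rw [mul_comm a₁ m]; omega) (by omega) d).trans (by ring)
    · exact h.discr_of_one_mod_four sma smb sab (by omega) (by omega) e
  · rcases two_mod_four_and_three_mod_four hm.emod_four ha.emod_four hb.emod_four
      (not_two_mod_four_of_isCoprime hma) (not_two_mod_four_of_isCoprime hmb)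
      (not_two_mod_four_of_isCoprime hab) c₁ c₂ with
      ⟨c, d⟩ | ⟨c, d⟩ | ⟨c, d⟩
    · exact h.discr_of_three_mod_four sma smb sab c d
    · exact (h.swap_yz.discr_of_three_mod_four sam sab smb c d).trans (by ring)
    · exact (h.swap_xy.swap_yz.discr_of_three_mod_four sbm sba sma c d).trans (by ring)
end
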